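/- Let n ≥ 1, let π be a permutation of [n], let x_1, …, x_r ∈ [n] be distinct, and let ρ be a permutation of [r]. Then for every permutation σ of [n], P(Swap(π; x_1, …, x_r) = σ) = P(Swap(π; x_{ρ(1)}, …, x_{ρ(r)}) = σ); that is, the distribution of the output of the swapping subroutine does not depend on the order in which the swaps are performed. -/

import Mathlib

open scoped Classical

/-- The result of the swapping subroutine `Swap(π; x_1, …, x_r)` when the random
choices are `c_1, …, c_r`: for `i = 1, …, r` in order, `π` is replaced by
`π ∘ (x_i c_i)`. -/
noncomputable def swapResult {n r : ℕ} (π : Equiv.Perm (Fin n)) (x c : Fin r → Fin n) :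
    Equiv.Perm (Fin n) :=
  (List.ofFn fun i => Equiv.swap (x i) (c i)).foldl (· * ·) π

/-- The set of valid random choices of the swapping subroutine: the `i`-th choice
`c i` is drawn uniformly from `[n] ∖ {x_1, …, x_{i-1}}`.  All valid choice tuples
are equally likely. -/
noncomputable def swapChoices (n r : ℕ) (x : Fin r → Fin n) : Finset (Fin r → Fin n) :=
  Finset.univ.filter fun c => ∀ i j : Fin r, j < i → c i ≠ x j

/-- `P(Swap(π; x_1, …, x_r) = σ)`: since every valid tuple of random choices is
equally likely, this is the fraction of valid choice tuples producing `σ`. -/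
noncomputable def swapProb {n r : ℕ} (π : Equiv.Perm (Fin n)) (x : Fin r → Fin n)
    (σ : Equiv.Perm (Fin n)) : ℝ :=
  (((swapChoices n r x).filter fun c => swapResult π x c = σ).card : ℝ) /
    ((swapChoices n r x).card : ℝ)

/-- A permutation fixes `A` pointwise, and each of its cycles contains at most one point
outside `L`; the latter is witnessed by an invariant labelling injective outside `L`. -/
def FixesAndSeparates {α : Type*} (A L : Set α) (τ : Equiv.Perm α) : Prop :=
  (∀ a ∈ A, τ a = a) ∧ ∃ f : α → ℕ, (∀ y, f (τ y) = f y) ∧ Set.InjOn f Lᶜ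

lemma fixesAndSeparates_insert {α : Type*} [Finite α] [DecidableEq α] {A L : Set α} {x : α}
    (hxA : x ∉ A) (τ : Equiv.Perm α) :
    FixesAndSeparates A (insert x L) τ ↔
      τ x ∉ A ∧ FixesAndSeparates (insert x A) L (Equiv.swap x (τ x) * τ) := by
  constructor
  · rintro ⟨hA, g, hg, hinj⟩
    have hc : τ x ∉ A := fun h => hxA (τ.injective (hA _ h) ▸ h)
    refine ⟨hc, ?_, ?_⟩
    · rintro a (rfl | ha)
      · simp
      · have h1 : a ≠ x := fun h => hxA (h ▸ ha)
        have h2 : a ≠ τ x := fun h => hc (h ▸ ha)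
        simp [hA a ha, Equiv.swap_apply_of_ne_of_ne h1 h2]
    · obtain ⟨N, hN⟩ := (Set.finite_range g).exists_notMem
      have hN' : ∀ y, g y ≠ N := fun y hy => hN ⟨y, hy⟩
      have hswap : ∀ y, g (Equiv.swap x (τ x) y) = g y := by
        intro y
        rw [Equiv.swap_apply_def]
        split_ifs with h1 h2
        · rw [h1, hg]
        · rw [h2, hg]
        · rfl
      refine ⟨Function.update g x N, fun y => ?_, fun a ha b hb hab => ?_⟩
      · by_cases hy : y = x
        · simp [hy]
        · have hne : (Equiv.swap x (τ x) * τ) y ≠ x := by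
            intro h
            apply hy
            apply (Equiv.swap x (τ x) * τ).injective
            simpa using h
          rw [Function.update_of_ne hne, Function.update_of_ne hy, Equiv.Perm.mul_apply, hswap, hg]
      · by_cases h1 : a = x <;> by_cases h2 : b = x
        · rw [h1, h2]
        · subst h1
          simp [Function.update_of_ne h2] at hab
          exact absurd hab.symm (hN' b)
        · subst h2
          simp [Function.update_of_ne h1] at hab
          exact absurd hab (hN' a)
        · rw [Function.update_of_ne h1, Function.update_of_ne h2] at hab
          exact hinj (by simp_all) (by simp_all) hab
  · rintro ⟨hc, hA, f, hf, hinj⟩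
    have hτ : ∀ y, τ y = Equiv.swap x (τ x) ((Equiv.swap x (τ x) * τ) y) := by simp
    refine ⟨fun a ha => ?_, Function.update f x (f (τ x)), fun y => ?_, fun a ha b hb hab => ?_⟩
    · have h1 : a ≠ x := fun h => hxA (h ▸ ha)
      have h2 : a ≠ τ x := fun h => hc (h ▸ ha)
      rw [hτ, hA a (Or.inr ha), Equiv.swap_apply_of_ne_of_ne h1 h2]
    · by_cases hy : y = x
      · subst hy
        by_cases h : τ y = y
        · rw [h]
        · simp [Function.update_of_ne h]
      · have h1 : τ y ≠ τ x := fun h => hy (τ.injective h)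
        have h2 := hf y
        rw [Function.update_of_ne hy, ← h2, Equiv.Perm.mul_apply]
        by_cases h : τ y = x
        · simp [h]
        · rw [Function.update_of_ne h, Equiv.swap_apply_of_ne_of_ne h h1]
    · simp only [Set.mem_compl_iff, Set.mem_insert_iff, not_or] at ha hb
      rw [Function.update_of_ne ha.1, Function.update_of_ne hb.1] at hab
      exact hinj ha.2 hb.2 hab

lemma fixesAndSeparates_empty_iff {α : Type*} [Finite α] {A : Set α} {τ : Equiv.Perm α} :
    FixesAndSeparates A ∅ τ ↔ τ = 1 := by
  constructor
  · rintro ⟨-, f, hf, hinj⟩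
    ext y
    exact hinj (by simp) (by simp) (hf y)
  · rintro rfl
    obtain ⟨f, hf⟩ := Countable.exists_injective_nat α
    exact ⟨fun _ _ => rfl, f, fun _ => rfl, hf.injOn⟩

/-- The choices `c` avoid `A`, and each `c i` avoids the points `x j` with `j < i`. -/
def ChoicesAvoid {α : Type*} {r : ℕ} (A : Set α) (x c : Fin r → α) : Prop :=
  (∀ i, c i ∉ A) ∧ ∀ i j : Fin r, j < i → c i ≠ x j

lemma choicesAvoid_succ {α : Type*} {r : ℕ} {A : Set α} {x c : Fin (r + 1) → α} :
    ChoicesAvoid A x c ↔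
      c 0 ∉ A ∧ ChoicesAvoid (insert (x 0) A) (fun i => x i.succ) (fun i => c i.succ) := by
  simp only [ChoicesAvoid, Fin.forall_fin_succ, Set.mem_insert_iff, not_or, Fin.succ_lt_succ_iff,
    Fin.succ_pos, forall_const, Fin.not_lt_zero, IsEmpty.forall_iff, forall_and]
  tauto

lemma range_fin_succ_eq_insert {α : Type*} {r : ℕ} (x : Fin (r + 1) → α) :
    Set.range x = insert (x 0) (Set.range fun i : Fin r => x i.succ) := by
  ext y
  simp [Fin.exists_fin_succ, eq_comm]

lemma exists_choicesAvoid_prod_swap_eq_iff {α : Type*} [Finite α] [DecidableEq α] {r : ℕ}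
    {A : Set α} {x : Fin r → α} (hx : Function.Injective x) (hxA : ∀ i, x i ∉ A)
    (τ : Equiv.Perm α) :
    (∃ c, ChoicesAvoid A x c ∧ (List.ofFn fun i => Equiv.swap (x i) (c i)).prod = τ) ↔
      FixesAndSeparates A (Set.range x) τ := by
  induction r generalizing A τ with
  | zero =>
    rw [Set.range_eq_empty, fixesAndSeparates_empty_iff]
    simp [ChoicesAvoid, eq_comm]
  | succ r ih =>
    have ih' := ih (A := insert (x 0) A) (x := fun i => x i.succ)
      (hx.comp (Fin.succ_injective r)) (fun i => by
        simp [hxA, hx.eq_iff, Fin.succ_ne_zero])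
    rw [range_fin_succ_eq_insert, fixesAndSeparates_insert (hxA 0), ← ih']
    constructor
    · rintro ⟨c, hc, rfl⟩
      rw [choicesAvoid_succ] at hc
      have hfix := ((ih' _).1 ⟨_, hc.2, rfl⟩).1 (x 0) (Or.inl rfl)
      simp only [List.ofFn_succ, List.prod_cons, Equiv.Perm.mul_apply, hfix,
        Equiv.swap_apply_left, Equiv.swap_mul_self_mul]
      exact ⟨hc.1, _, hc.2, rfl⟩
    · rintro ⟨h0, c, hc, hprod⟩
      refine ⟨Fin.cons (τ (x 0)) c, ?_, ?_⟩
      · rw [choicesAvoid_succ]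
        simpa using ⟨h0, hc⟩
      · simp [List.ofFn_succ, hprod]

lemma eq_of_prod_swap_eq {α : Type*} [Finite α] [DecidableEq α] {r : ℕ}
    {A : Set α} {x c d : Fin r → α} (hx : Function.Injective x) (hxA : ∀ i, x i ∉ A)
    (hc : ChoicesAvoid A x c) (hd : ChoicesAvoid A x d)
    (h : (List.ofFn fun i => Equiv.swap (x i) (c i)).prod =
      (List.ofFn fun i => Equiv.swap (x i) (d i)).prod) : c = d := by
  induction r generalizing A with
  | zero => exact Subsingleton.elim _ _
  | succ r ih =>
    rw [choicesAvoid_succ] at hc hd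
    have hx' : Function.Injective fun i : Fin r => x i.succ := hx.comp (Fin.succ_injective r)
    have hxA' : ∀ i : Fin r, x i.succ ∉ insert (x 0) A := fun i => by
      simp [hxA, hx.eq_iff, Fin.succ_ne_zero]
    have hfix {e} (he : ChoicesAvoid (insert (x 0) A) (fun i => x i.succ) e) :=
      ((exists_choicesAvoid_prod_swap_eq_iff hx' hxA' _).1 ⟨e, he, rfl⟩).1 (x 0) (Or.inl rfl)
    simp only [List.ofFn_succ, List.prod_cons] at h
    have h0 : c 0 = d 0 := by
      simpa [Equiv.Perm.mul_apply, hfix hc.2, hfix hd.2] using DFunLike.congr_fun h (x 0)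
    rw [h0, mul_right_inj] at h
    have ht := ih hx' hxA' hc.2 hd.2 h
    funext i
    exact Fin.cases h0 (congrFun ht) i

lemma swapResult_eq_mul_prod {n r : ℕ} (π : Equiv.Perm (Fin n)) (x c : Fin r → Fin n) :
    swapResult π x c = π * (List.ofFn fun i => Equiv.swap (x i) (c i)).prod := by
  have h := List.foldl_assoc (op := fun a b : Equiv.Perm (Fin n) => a * b)
    (ha := ⟨mul_assoc⟩) (l := List.ofFn fun i => Equiv.swap (x i) (c i)) (a₁ := π) (a₂ := 1)
  rw [swapResult, List.prod_eq_foldl, ← h, mul_one]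

lemma mem_swapChoices_iff {n r : ℕ} {x c : Fin r → Fin n} :
    c ∈ swapChoices n r x ↔ ChoicesAvoid ∅ x c := by
  simp [swapChoices, ChoicesAvoid]

lemma card_filter_swapChoices {n r : ℕ} (π : Equiv.Perm (Fin n)) {x : Fin r → Fin n}
    (hx : Function.Injective x) (p : Equiv.Perm (Fin n) → Prop) [DecidablePred p] :
    ((swapChoices n r x).filter fun c => p (swapResult π x c)).card =
      (Finset.univ.filter fun σ => FixesAndSeparates ∅ (Set.range x) (π⁻¹ * σ) ∧ p σ).card := by
  rw [← Finset.card_image_of_injOn (f := swapResult π x)]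
  · congr 1
    ext σ
    simp only [Finset.mem_image, Finset.mem_filter, Finset.mem_univ, true_and,
      ← exists_choicesAvoid_prod_swap_eq_iff hx (fun _ => Set.notMem_empty _),
      mem_swapChoices_iff, swapResult_eq_mul_prod, eq_inv_mul_iff_mul_eq]
    constructor
    · rintro ⟨c, ⟨hc, hp⟩, rfl⟩
      exact ⟨⟨c, hc, rfl⟩, hp⟩
    · rintro ⟨⟨c, hc, rfl⟩, hp⟩
      exact ⟨c, ⟨hc, hp⟩, rfl⟩
  · intro c hc d hd h
    simp only [Finset.coe_filter, Set.mem_ofPred_eq, mem_swapChoices_iff] at hc hd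
    rw [swapResult_eq_mul_prod, swapResult_eq_mul_prod, mul_right_inj] at h
    exact eq_of_prod_swap_eq hx (fun _ => Set.notMem_empty _) hc.1 hd.1 h

/-- The distribution of the output of the swapping subroutine does not depend on
the order in which the swaps are performed: for any permutation `ρ` of `[r]`,
`P(Swap(π; x_1, …, x_r) = σ) = P(Swap(π; x_{ρ(1)}, …, x_{ρ(r)}) = σ)`. -/
theorem swap_order_invariant (n : ℕ) (hn : 1 ≤ n) (r : ℕ)
    (π : Equiv.Perm (Fin n)) (x : Fin r → Fin n) (hx : Function.Injective x)
    (ρ : Equiv.Perm (Fin r)) (σ : Equiv.Perm (Fin n)) :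
    swapProb π x σ = swapProb π (fun i => x (ρ i)) σ := by
  have hx' : Function.Injective fun i => x (ρ i) := hx.comp ρ.injective
  have hrange : Set.range (fun i => x (ρ i)) = Set.range x := ρ.surjective.range_comp x
  have hcard : (swapChoices n r x).card = (swapChoices n r fun i => x (ρ i)).card := by
    have h := card_filter_swapChoices π hx fun _ => True
    have h' := card_filter_swapChoices π hx' fun _ => True
    rw [hrange, ← h] at h'
    simpa using h'.symm
  rw [swapProb, swapProb, hcard, card_filter_swapChoices π hx (· = σ),
    card_filter_swapChoices π hx' (· = σ), hrange]
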